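/- Let θ ∈ (0,1) and α ∈ (0, 1−θ). Then there exists a unique function f ∈ F_α satisfying T(f) = f, i.e., a unique measurable f : [1,∞) → [0,1] with sup_{s≥1} s^α |f(s)| < ∞ such that f(s) = 1 − (1 − 1/s)^θ + θ(s−1)^θ ∫_1^∞ (s + t − 1)^{−θ−1} f(t) dt for all s ≥ 1 (uniqueness meaning any two such functions agree almost everywhere). -/

import Mathlib

open MeasureTheory Real Set

/-- The operator `T` from the integral equation for crossing probabilities. -/
noncomputable def T (θ : ℝ) (f : ℝ → ℝ) : ℝ → ℝ :=
  fun s => 1 - (1 - 1 / s) ^ θ +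
    θ * (s - 1) ^ θ * ∫ t in Ioi (1 : ℝ), (s + t - 1) ^ (-θ - 1) * f t

/-- Membership in the space `F_α`: `f` is measurable, takes values in `[0,1]` on
`[1,∞)`, and `sup_{s ≥ 1} s^α |f s| < ∞`. -/
def MemF (α : ℝ) (f : ℝ → ℝ) : Prop :=
  Measurable f ∧ (∀ s, 1 ≤ s → f s ∈ Icc (0 : ℝ) 1) ∧
    BddAbove ((fun s => s ^ α * |f s|) '' Ici 1)

theorem integrableOn_kernel {θ s : ℝ} (hθ : 0 < θ) (hs : 1 ≤ s) :
    IntegrableOn (fun t : ℝ => (s + t - 1) ^ (-θ - 1)) (Ioi 1) := by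
  have h := integrableOn_add_rpow_Ioi_of_lt (a := -θ - 1) (c := 1) (m := s - 1)
    (by linarith) (by linarith)
  refine h.congr_fun (fun t _ => ?_) measurableSet_Ioi
  simp only
  congr 1
  ring

theorem integral_kernel {θ s : ℝ} (hθ : 0 < θ) (hs : 1 ≤ s) :
    ∫ t in Ioi (1 : ℝ), (s + t - 1) ^ (-θ - 1) = s ^ (-θ) / θ := by
  have hd : ∀ t ∈ Ici (1 : ℝ),
      HasDerivAt (fun t : ℝ => -(s + t - 1) ^ (-θ) / θ) ((s + t - 1) ^ (-θ - 1)) t := by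
    intro t ht
    have ht' : (1 : ℝ) ≤ t := ht
    have h1 : HasDerivAt (fun t : ℝ => s + t - 1) 1 t :=
      ((hasDerivAt_id t).const_add s).sub_const 1
    refine ((h1.rpow_const (p := -θ) (Or.inl (by linarith))).neg.div_const θ).congr_deriv ?_
    rw [one_mul, neg_mul, neg_neg, mul_div_cancel_left₀ _ hθ.ne']
  have hlim : Filter.Tendsto (fun t : ℝ => -(s + t - 1) ^ (-θ) / θ) Filter.atTop (nhds 0) := by
    have h1 : Filter.Tendsto (fun t : ℝ => s + t - 1) Filter.atTop Filter.atTop := by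
      simpa only [sub_eq_add_neg, id] using Filter.tendsto_atTop_add_const_right _ (-1 : ℝ)
        (Filter.tendsto_atTop_add_const_left _ s Filter.tendsto_id)
    simpa using (((tendsto_rpow_neg_atTop hθ).comp h1).neg.div_const θ)
  rw [integral_Ioi_of_hasDerivAt_of_nonneg' hd
    (fun t ht => rpow_nonneg (by have : (1 : ℝ) < t := ht; linarith) _) hlim]
  rw [show s + 1 - 1 = s by ring]
  ring

theorem integral_kernel_mul {θ s : ℝ} (hθ : 0 < θ) (hs : 1 ≤ s) :
    θ * (s - 1) ^ θ * ∫ t in Ioi (1 : ℝ), (s + t - 1) ^ (-θ - 1) = (1 - 1 / s) ^ θ := by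
  have hs0 : 0 < s := by linarith
  rw [integral_kernel hθ hs, one_sub_div hs0.ne', div_rpow (by linarith) hs0.le,
    rpow_neg hs0.le]
  field_simp

/-- The constant is the value at `α` of a strictly log-convex function of the exponent which
equals `1` at `0` and at `1 - θ`. -/
theorem integral_beta_lt_one {θ α : ℝ} (hθ : θ ∈ Ioo (0 : ℝ) 1) (hα : α ∈ Ioo (0 : ℝ) (1 - θ)) :
    IntegrableOn (fun u : ℝ => θ * ((1 + u) ^ (-θ - 1) * u ^ (-α))) (Ioi 0) ∧
      ∫ u in Ioi (0 : ℝ), θ * ((1 + u) ^ (-θ - 1) * u ^ (-α)) < 1 := by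
  obtain ⟨hθ0, hθ1⟩ := hθ
  obtain ⟨hα0, hα1⟩ := hα
  have h1θ : 0 < 1 - θ := by linarith
  set r : ℝ := α / (1 - θ) with hr
  have hr0 : 0 < r := div_pos hα0 h1θ
  have hr1 : r < 1 := (div_lt_one h1θ).2 hα1
  set ψ : ℝ → ℝ := fun u => θ * ((1 + u) ^ (-θ - 1) * ((1 - r) + r * u ^ (θ - 1))) with hψ
  have hψ0 : ∀ u ∈ Ioi (0 : ℝ), 0 ≤ ψ u := by
    intro u hu
    have : (0 : ℝ) < u := hu
    have : 0 < 1 - r := by linarith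
    positivity
  set G : ℝ → ℝ := fun u => (1 - r) * (-(1 + u) ^ (-θ)) + r * (u / (1 + u)) ^ θ with hG
  have hcont : ContinuousWithinAt G (Ici 0) 0 := by
    apply ContinuousAt.continuousWithinAt
    have h1 : ContinuousAt (fun u : ℝ => (1 + u) ^ (-θ)) 0 :=
      ContinuousAt.rpow_const (by fun_prop) (Or.inl (by norm_num))
    have h2 : ContinuousAt (fun u : ℝ => (u / (1 + u)) ^ θ) 0 :=
      ContinuousAt.rpow_const (ContinuousAt.div (by fun_prop) (by fun_prop) (by norm_num))
        (Or.inr hθ0.le)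
    exact (h1.neg.const_mul _).add (h2.const_mul _)
  have hderiv : ∀ u ∈ Ioi (0 : ℝ), HasDerivAt G (ψ u) u := by
    intro u hu
    have hu0 : (0 : ℝ) < u := hu
    have hu1 : 0 < 1 + u := by linarith
    have h1 : HasDerivAt (fun u : ℝ => 1 + u) 1 u := (hasDerivAt_id u).const_add 1
    have h2 := (h1.rpow_const (p := -θ) (Or.inl hu1.ne')).neg.const_mul (1 - r)
    have h3 := (((hasDerivAt_id u).div h1 hu1.ne').rpow_const (p := θ)
      (Or.inl (div_pos hu0 hu1).ne')).const_mul r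
    refine (h2.add h3).congr_deriv ?_
    have e1 : (1 + u) ^ (-θ - 1) = (1 + u) ^ (-(2 : ℝ)) / (1 + u) ^ (θ - 1) := by
      rw [← rpow_sub hu1]; congr 1; ring
    have e2 : (1 + u) ^ (-(2 : ℝ)) = ((1 + u) ^ 2)⁻¹ := by
      rw [rpow_neg hu1.le]; norm_cast
    have e3 : ((id / fun u : ℝ => 1 + u : ℝ → ℝ)) u ^ (θ - 1) = u ^ (θ - 1) / (1 + u) ^ (θ - 1) :=
      div_rpow hu0.le hu1.le _
    rw [e3, hψ]
    simp only [id]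
    rw [e1, e2]
    have : 0 < (1 + u) ^ (θ - 1) := rpow_pos_of_pos hu1 _
    field_simp
    ring
  have hlim : Filter.Tendsto G Filter.atTop (nhds r) := by
    have h1 : Filter.Tendsto (fun u : ℝ => 1 + u) Filter.atTop Filter.atTop :=
      Filter.tendsto_atTop_add_const_left _ 1 Filter.tendsto_id
    have h2 := (tendsto_rpow_neg_atTop hθ0).comp h1
    have h3 : Filter.Tendsto (fun u : ℝ => u / (1 + u)) Filter.atTop (nhds 1) := by
      have h4 : Filter.Tendsto (fun u : ℝ => 1 - (1 + u)⁻¹) Filter.atTop (nhds (1 - 0)) :=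
        (tendsto_inv_atTop_zero.comp h1).const_sub 1
      rw [sub_zero] at h4
      refine h4.congr' ?_
      filter_upwards [Filter.eventually_gt_atTop 0] with u hu
      field_simp
      ring
    have h5 := h3.rpow_const (p := θ) (Or.inl one_ne_zero)
    simpa [hG] using (h2.neg.const_mul (1 - r)).add (h5.const_mul r)
  have hψi : IntegrableOn ψ (Ioi 0) := integrableOn_Ioi_deriv_of_nonneg hcont hderiv hψ0 hlim
  have hψ1 : ∫ u in Ioi (0 : ℝ), ψ u = 1 := by
    rw [integral_Ioi_of_hasDerivAt_of_nonneg hcont hderiv hψ0 hlim]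
    simp [hG, hθ0.ne']
  have key : ∀ u ∈ Ioi (0 : ℝ), u ^ (-α) = (1 + (u ^ (θ - 1) - 1)) ^ r := by
    intro u hu
    rw [add_sub_cancel, ← rpow_mul (le_of_lt hu)]
    congr 1
    rw [hr]
    field_simp
    ring
  have hneg : ∀ u ∈ Ioi (0 : ℝ), -1 ≤ u ^ (θ - 1) - 1 := fun u hu => by
    have := rpow_nonneg (le_of_lt hu) (θ - 1)
    linarith
  have hle : ∀ u ∈ Ioi (0 : ℝ), θ * ((1 + u) ^ (-θ - 1) * u ^ (-α)) ≤ ψ u := by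
    intro u hu
    have hu0 : (0 : ℝ) < u := hu
    have h := rpow_one_add_le_one_add_mul_self (hneg u hu) hr0.le hr1.le
    rw [← key u hu] at h
    simp only [hψ]
    gcongr
    linarith
  have hlt : ∀ u ∈ Ioo (1 : ℝ) 2, θ * ((1 + u) ^ (-θ - 1) * u ^ (-α)) < ψ u := by
    intro u hu
    have hu0 : (0 : ℝ) < u := by linarith [hu.1]
    have hne : u ^ (θ - 1) - 1 ≠ 0 := by
      have := rpow_lt_one_of_one_lt_of_neg hu.1 (by linarith : θ - 1 < 0)
      linarith
    have h := rpow_one_add_lt_one_add_mul_self (hneg u hu0) hne hr0 hr1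
    rw [← key u hu0] at h
    simp only [hψ]
    gcongr
    linarith
  have hφi : IntegrableOn (fun u : ℝ => θ * ((1 + u) ^ (-θ - 1) * u ^ (-α))) (Ioi 0) := by
    refine hψi.mono' (by fun_prop) ?_
    refine (ae_restrict_iff' measurableSet_Ioi).2 (Filter.Eventually.of_forall fun u hu => ?_)
    have hu0 : (0 : ℝ) < u := hu
    rw [norm_of_nonneg (by positivity)]
    exact hle u hu
  refine ⟨hφi, ?_⟩
  have hpos : 0 < ∫ u in Ioi (0 : ℝ), (ψ u - θ * ((1 + u) ^ (-θ - 1) * u ^ (-α))) := by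
    rw [setIntegral_pos_iff_support_of_nonneg_ae
      ((ae_restrict_iff' measurableSet_Ioi).2 (Filter.Eventually.of_forall fun u hu =>
        sub_nonneg.2 (hle u hu))) (hψi.sub hφi)]
    refine lt_of_lt_of_le ?_ (measure_mono (show Ioo (1 : ℝ) 2 ⊆ _ from fun u hu =>
      ⟨(sub_pos.2 (hlt u hu)).ne', show (0 : ℝ) < u by linarith [hu.1]⟩))
    simp
  rw [integral_sub hψi hφi, hψ1] at hpos
  linarith

theorem integrableOn_kernel_mul {θ s : ℝ} (hθ : 0 < θ) (hs : 1 ≤ s) {f : ℝ → ℝ}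
    (hf : Measurable f) (hf1 : ∀ t, 1 ≤ t → |f t| ≤ 1) :
    IntegrableOn (fun t : ℝ => (s + t - 1) ^ (-θ - 1) * f t) (Ioi 1) := by
  refine (integrableOn_kernel hθ hs).mono' (by fun_prop) ?_
  refine (ae_restrict_iff' measurableSet_Ioi).2 (Filter.Eventually.of_forall fun t ht => ?_)
  have ht1 : (1 : ℝ) < t := ht
  have h0 : 0 ≤ (s + t - 1) ^ (-θ - 1) := rpow_nonneg (by linarith) _
  rw [norm_mul, norm_of_nonneg h0, Real.norm_eq_abs]
  exact mul_le_of_le_one_right h0 (hf1 t ht1.le)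

theorem exists_contraction_const {θ α : ℝ} (hθ : θ ∈ Ioo (0 : ℝ) 1)
    (hα : α ∈ Ioo (0 : ℝ) (1 - θ)) :
    ∃ c : ℝ, 0 ≤ c ∧ c < 1 ∧ ∀ s : ℝ, 1 ≤ s →
      θ * (s - 1) ^ θ * ∫ t in Ioi (1 : ℝ), (s + t - 1) ^ (-θ - 1) * t ^ (-α) ≤
        c * s ^ (-α) := by
  obtain ⟨hi, hlt⟩ := integral_beta_lt_one hθ hα
  have hθ0 := hθ.1
  have hα0 := hα.1
  set c := ∫ u in Ioi (0 : ℝ), θ * ((1 + u) ^ (-θ - 1) * u ^ (-α)) with hc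
  have hc0 : 0 ≤ c := setIntegral_nonneg measurableSet_Ioi fun u hu => by
    have : (0 : ℝ) < u := hu
    positivity
  refine ⟨c, hc0, hlt, fun s hs => ?_⟩
  have hs0 : 0 < s := by linarith
  set F : ℝ → ℝ := fun t => (s + t - 1) ^ (-θ - 1) * (t - 1) ^ (-α) with hF
  have himg : (fun u : ℝ => 1 + s * u) '' Ioi 0 = Ioi 1 := by
    ext t
    simp only [mem_image, mem_Ioi]
    constructor
    · rintro ⟨u, hu, rfl⟩
      have := mul_pos hs0 hu
      linarith
    · intro ht
      exact ⟨(t - 1) / s, div_pos (by linarith) hs0, by field_simp; ring⟩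
  have hd : ∀ u ∈ Ioi (0 : ℝ), HasDerivWithinAt (fun u : ℝ => 1 + s * u) s (Ioi 0) u := by
    intro u _
    simpa using (((hasDerivAt_id u).const_mul s).const_add 1).hasDerivWithinAt
  have hinj : InjOn (fun u : ℝ => 1 + s * u) (Ioi 0) := fun u _ v _ h => by
    simpa [hs0.ne'] using h
  have hsub : ∀ u ∈ Ioi (0 : ℝ), |s| • F (1 + s * u) =
      s ^ (-θ - α) / θ * (θ * ((1 + u) ^ (-θ - 1) * u ^ (-α))) := by
    intro u hu
    have hu0 : (0 : ℝ) < u := hu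
    simp only [hF, smul_eq_mul, abs_of_pos hs0]
    rw [show s + (1 + s * u) - 1 = s * (1 + u) by ring, show 1 + s * u - 1 = s * u by ring,
      mul_rpow hs0.le (by linarith), mul_rpow hs0.le hu0.le,
      show -θ - α = 1 + (-θ - 1) + (-α) by ring, rpow_add hs0, rpow_add hs0, rpow_one]
    field_simp
  have hFi : IntegrableOn F (Ioi 1) := by
    rw [← himg, integrableOn_image_iff_integrableOn_abs_deriv_smul measurableSet_Ioi hd hinj]
    exact IntegrableOn.congr_fun (hi.const_mul _) (fun u hu => (hsub u hu).symm)
      measurableSet_Ioi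
  have hFint : ∫ t in Ioi (1 : ℝ), F t = s ^ (-θ - α) / θ * c := by
    rw [← himg, integral_image_eq_integral_abs_deriv_smul measurableSet_Ioi hd hinj,
      setIntegral_congr_fun measurableSet_Ioi hsub, integral_const_mul]
  have hle : ∫ t in Ioi (1 : ℝ), (s + t - 1) ^ (-θ - 1) * t ^ (-α) ≤ s ^ (-θ - α) / θ * c := by
    rw [← hFint]
    refine setIntegral_mono_on (integrableOn_kernel_mul hθ0 hs (by fun_prop) fun t ht => ?_) hFi
      measurableSet_Ioi fun t ht => ?_
    · rw [abs_of_nonneg (rpow_nonneg (by linarith) _)]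
      exact rpow_le_one_of_one_le_of_nonpos ht (by linarith)
    · have ht1 : (1 : ℝ) < t := ht
      exact mul_le_mul_of_nonneg_left
        (rpow_le_rpow_of_nonpos (by linarith) (by linarith) (by linarith))
        (rpow_nonneg (by linarith) _)
  calc θ * (s - 1) ^ θ * ∫ t in Ioi (1 : ℝ), (s + t - 1) ^ (-θ - 1) * t ^ (-α)
      ≤ θ * s ^ θ * (s ^ (-θ - α) / θ * c) := by
        have h1 : (s - 1) ^ θ ≤ s ^ θ := rpow_le_rpow (by linarith) (by linarith) hθ0.le
        have h2 : 0 ≤ (s - 1) ^ θ := rpow_nonneg (by linarith) _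
        have h3 : 0 ≤ s ^ (-θ - α) / θ * c := by positivity
        exact (mul_le_mul_of_nonneg_left hle (by positivity)).trans
          (mul_le_mul_of_nonneg_right (mul_le_mul_of_nonneg_left h1 hθ0.le) h3)
    _ = c * s ^ (-α) := by
        rw [show -α = θ + (-θ - α) by ring, rpow_add hs0]
        field_simp

theorem T_mono {θ s : ℝ} (hθ : 0 < θ) (hs : 1 ≤ s) {f g : ℝ → ℝ}
    (hf : Measurable f) (hf1 : ∀ t, 1 ≤ t → |f t| ≤ 1)
    (hg : Measurable g) (hg1 : ∀ t, 1 ≤ t → |g t| ≤ 1) (h : ∀ t, 1 ≤ t → f t ≤ g t) :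
    T θ f s ≤ T θ g s := by
  have h2 : 0 ≤ (s - 1) ^ θ := rpow_nonneg (by linarith) _
  refine add_le_add_right (mul_le_mul_of_nonneg_left ?_ (by positivity)) _
  refine setIntegral_mono_on (integrableOn_kernel_mul hθ hs hf hf1)
    (integrableOn_kernel_mul hθ hs hg hg1) measurableSet_Ioi fun t ht => ?_
  have ht1 : (1 : ℝ) < t := ht
  exact mul_le_mul_of_nonneg_left (h t ht1.le) (rpow_nonneg (by linarith) _)

theorem T_zero (θ s : ℝ) : T θ (fun _ => 0) s = 1 - (1 - 1 / s) ^ θ := by simp [T]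

theorem T_one {θ s : ℝ} (hθ : 0 < θ) (hs : 1 ≤ s) : T θ (fun _ => 1) s = 1 := by
  simp only [T, mul_one]
  rw [integral_kernel_mul hθ hs]
  ring

theorem one_sub_one_div_mem {s : ℝ} (hs : 1 ≤ s) : 1 - 1 / s ∈ Icc (0 : ℝ) 1 := by
  have h1 : 1 / s ≤ 1 := (div_le_one (by linarith)).2 hs
  have h2 : 0 < 1 / s := by positivity
  constructor <;> linarith

theorem T_mem_Icc {θ s : ℝ} (hθ : 0 < θ) (hs : 1 ≤ s) {f : ℝ → ℝ} (hf : Measurable f)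
    (hf1 : ∀ t, 1 ≤ t → f t ∈ Icc (0 : ℝ) 1) : T θ f s ∈ Icc (0 : ℝ) 1 := by
  have habs : ∀ t, 1 ≤ t → |f t| ≤ 1 := fun t ht =>
    abs_le.2 ⟨by linarith [(hf1 t ht).1], (hf1 t ht).2⟩
  constructor
  · refine le_trans ?_ (T_mono hθ hs (measurable_const (a := (0 : ℝ))) (by simp) hf habs
      fun t ht => (hf1 t ht).1)
    obtain ⟨h0, h1⟩ := one_sub_one_div_mem hs
    rw [T_zero]
    linarith [rpow_le_one h0 h1 hθ.le]
  · rw [← T_one hθ hs]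
    exact T_mono hθ hs hf habs (measurable_const (a := (1 : ℝ))) (by simp) fun t ht => (hf1 t ht).2

theorem measurable_T (θ : ℝ) {f : ℝ → ℝ} (hf : Measurable f) : Measurable (T θ f) := by
  have h : Measurable fun s : ℝ => ∫ t in Ioi (1 : ℝ), (s + t - 1) ^ (-θ - 1) * f t := by
    refine (StronglyMeasurable.integral_prod_right (ν := volume.restrict (Ioi (1 : ℝ)))
      (f := fun s t : ℝ => (s + t - 1) ^ (-θ - 1) * f t) ?_).measurable
    exact Measurable.stronglyMeasurable (by fun_prop)
  unfold T
  fun_prop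

theorem abs_T_sub_le {θ α c : ℝ} (hθ : 0 < θ) (hα : 0 < α)
    (hc : ∀ s : ℝ, 1 ≤ s →
      θ * (s - 1) ^ θ * ∫ t in Ioi (1 : ℝ), (s + t - 1) ^ (-θ - 1) * t ^ (-α) ≤ c * s ^ (-α))
    {f g : ℝ → ℝ} (hf : Measurable f) (hf1 : ∀ t, 1 ≤ t → |f t| ≤ 1)
    (hg : Measurable g) (hg1 : ∀ t, 1 ≤ t → |g t| ≤ 1) {K : ℝ} (hK : 0 ≤ K)
    (h : ∀ t, 1 ≤ t → |f t - g t| ≤ K * t ^ (-α)) {s : ℝ} (hs : 1 ≤ s) :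
    |T θ f s - T θ g s| ≤ c * K * s ^ (-α) := by
  have h2 : 0 ≤ θ * (s - 1) ^ θ := mul_nonneg hθ.le (rpow_nonneg (by linarith) _)
  have hpow : IntegrableOn (fun t : ℝ => (s + t - 1) ^ (-θ - 1) * t ^ (-α)) (Ioi 1) :=
    integrableOn_kernel_mul hθ hs (by fun_prop) fun t ht => by
      rw [abs_of_nonneg (rpow_nonneg (by linarith) _)]
      exact rpow_le_one_of_one_le_of_nonpos ht (by linarith)
  have hint : |∫ t in Ioi (1 : ℝ), ((s + t - 1) ^ (-θ - 1) * f t - (s + t - 1) ^ (-θ - 1) * g t)| ≤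
      ∫ t in Ioi (1 : ℝ), K * ((s + t - 1) ^ (-θ - 1) * t ^ (-α)) := by
    rw [← Real.norm_eq_abs]
    refine norm_integral_le_of_norm_le (hpow.const_mul K)
      ((ae_restrict_iff' measurableSet_Ioi).2 (Filter.Eventually.of_forall fun t ht => ?_))
    have ht1 : (1 : ℝ) < t := ht
    have h0 : 0 ≤ (s + t - 1) ^ (-θ - 1) := rpow_nonneg (by linarith) _
    rw [← mul_sub, norm_mul, norm_of_nonneg h0, Real.norm_eq_abs, mul_left_comm]
    exact mul_le_mul_of_nonneg_left (h t ht1.le) h0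
  rw [integral_sub (integrableOn_kernel_mul hθ hs hf hf1) (integrableOn_kernel_mul hθ hs hg hg1),
    integral_const_mul] at hint
  simp only [T]
  rw [add_sub_add_left_eq_sub, ← mul_sub, abs_mul, abs_of_nonneg h2]
  calc _ ≤ θ * (s - 1) ^ θ *
        (K * ∫ t in Ioi (1 : ℝ), (s + t - 1) ^ (-θ - 1) * t ^ (-α)) :=
        mul_le_mul_of_nonneg_left hint h2
    _ = K * (θ * (s - 1) ^ θ * ∫ t in Ioi (1 : ℝ), (s + t - 1) ^ (-θ - 1) * t ^ (-α)) := by ring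
    _ ≤ K * (c * s ^ (-α)) := mul_le_mul_of_nonneg_left (hc s hs) hK
    _ = c * K * s ^ (-α) := by ring

theorem MemF.abs_le_one {α : ℝ} {f : ℝ → ℝ} (hf : MemF α f) (t : ℝ) (ht : 1 ≤ t) : |f t| ≤ 1 :=
  abs_le.2 ⟨by linarith [(hf.2.1 t ht).1], (hf.2.1 t ht).2⟩

theorem MemF.exists_bound {α : ℝ} {f : ℝ → ℝ} (hf : MemF α f) :
    ∃ K, 0 ≤ K ∧ ∀ t, 1 ≤ t → |f t| ≤ K * t ^ (-α) := by
  obtain ⟨K, hK⟩ := hf.2.2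
  have hb : ∀ t, 1 ≤ t → t ^ α * |f t| ≤ K := fun t ht => hK ⟨t, ht, rfl⟩
  refine ⟨K, le_trans (by positivity) (hb 1 le_rfl), fun t ht => ?_⟩
  have ht0 : 0 < t := by linarith
  rw [rpow_neg ht0.le, ← div_eq_mul_inv, le_div_iff₀ (rpow_pos_of_pos ht0 _), mul_comm]
  exact hb t ht

theorem MemF.eq_of_fixed {θ α : ℝ} (hθ : θ ∈ Ioo (0 : ℝ) 1) (hα : α ∈ Ioo (0 : ℝ) (1 - θ))
    {f g : ℝ → ℝ} (hf : MemF α f) (hfT : ∀ s, 1 ≤ s → T θ f s = f s)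
    (hg : MemF α g) (hgT : ∀ s, 1 ≤ s → T θ g s = g s) {s : ℝ} (hs : 1 ≤ s) : f s = g s := by
  obtain ⟨c, hc0, hc1, hc⟩ := exists_contraction_const hθ hα
  obtain ⟨K, hK0, hK⟩ := hf.exists_bound
  obtain ⟨L, hL0, hL⟩ := hg.exists_bound
  have hn : ∀ n : ℕ, ∀ t, 1 ≤ t → |f t - g t| ≤ c ^ n * (K + L) * t ^ (-α) := by
    intro n
    induction n with
    | zero =>
      intro t ht
      calc |f t - g t| ≤ |f t| + |g t| := abs_sub _ _
        _ ≤ K * t ^ (-α) + L * t ^ (-α) := add_le_add (hK t ht) (hL t ht)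
        _ = c ^ 0 * (K + L) * t ^ (-α) := by ring
    | succ n ih =>
      intro t ht
      rw [← hfT t ht, ← hgT t ht, pow_succ', mul_assoc c]
      exact abs_T_sub_le hθ.1 hα.1 hc hf.1 hf.abs_le_one hg.1 hg.abs_le_one (by positivity) ih ht
  have hlim : Filter.Tendsto (fun n : ℕ => c ^ n * (K + L) * s ^ (-α)) Filter.atTop (nhds 0) := by
    simpa using ((tendsto_pow_atTop_nhds_zero_of_lt_one hc0 hc1).mul_const (K + L)).mul_const
      (s ^ (-α))
  have h0 : |f s - g s| ≤ 0 := ge_of_tendsto' hlim fun n => hn n s hs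
  exact sub_eq_zero.1 (abs_nonpos_iff.1 h0)

/-- Iterates of `T` from `0`, cut off to vanish outside `[1,∞)`. -/
noncomputable def picard (θ : ℝ) : ℕ → ℝ → ℝ
  | 0 => fun _ => 0
  | n + 1 => (Ici 1).indicator (T θ (picard θ n))

theorem picard_succ {θ s : ℝ} (n : ℕ) (hs : 1 ≤ s) : picard θ (n + 1) s = T θ (picard θ n) s :=
  indicator_of_mem (show s ∈ Ici (1 : ℝ) from hs) _

theorem measurable_picard (θ : ℝ) (n : ℕ) : Measurable (picard θ n) := by
  induction n with
  | zero => exact measurable_const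
  | succ n ih => exact (measurable_T θ ih).indicator measurableSet_Ici

theorem picard_mem_Icc {θ : ℝ} (hθ : 0 < θ) (n : ℕ) (s : ℝ) (hs : 1 ≤ s) :
    picard θ n s ∈ Icc (0 : ℝ) 1 := by
  induction n generalizing s with
  | zero => simp [picard]
  | succ n ih =>
    rw [picard_succ n hs]
    exact T_mem_Icc hθ hs (measurable_picard θ n) ih

theorem abs_picard_le_one {θ : ℝ} (hθ : 0 < θ) (n : ℕ) (s : ℝ) (hs : 1 ≤ s) :
    |picard θ n s| ≤ 1 :=
  abs_le.2 ⟨by linarith [(picard_mem_Icc hθ n s hs).1], (picard_mem_Icc hθ n s hs).2⟩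

theorem picard_le_succ {θ : ℝ} (hθ : 0 < θ) (n : ℕ) (s : ℝ) (hs : 1 ≤ s) :
    picard θ n s ≤ picard θ (n + 1) s := by
  induction n generalizing s with
  | zero => exact (picard_mem_Icc hθ 1 s hs).1
  | succ n ih =>
    rw [picard_succ n hs, picard_succ (n + 1) hs]
    exact T_mono hθ hs (measurable_picard θ n) (abs_picard_le_one hθ n)
      (measurable_picard θ (n + 1)) (abs_picard_le_one hθ (n + 1)) ih

theorem picard_le {θ α c : ℝ} (hθ : θ ∈ Ioo (0 : ℝ) 1) (hα : α ∈ Ioo (0 : ℝ) (1 - θ))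
    (hc1 : c < 1)
    (hc : ∀ s : ℝ, 1 ≤ s →
      θ * (s - 1) ^ θ * ∫ t in Ioi (1 : ℝ), (s + t - 1) ^ (-θ - 1) * t ^ (-α) ≤ c * s ^ (-α))
    (n : ℕ) (s : ℝ) (hs : 1 ≤ s) : picard θ n s ≤ 1 / (1 - c) * s ^ (-α) := by
  have h1c : 0 < 1 - c := by linarith
  induction n generalizing s with
  | zero =>
    have hs0 : 0 < s := by linarith
    simp only [picard]
    positivity
  | succ n ih =>
    have hs0 : 0 < s := by linarith
    have h := abs_T_sub_le hθ.1 hα.1 hc (measurable_picard θ n) (abs_picard_le_one hθ.1 n)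
      (measurable_const (a := (0 : ℝ))) (by simp) (K := 1 / (1 - c)) (by positivity)
      (fun t ht => by
        rw [sub_zero, abs_of_nonneg (picard_mem_Icc hθ.1 n t ht).1]
        exact ih t ht) hs
    rw [T_zero] at h
    have h0 : 1 - (1 - 1 / s) ^ θ ≤ s ^ (-α) := by
      obtain ⟨hl, hu⟩ := one_sub_one_div_mem hs
      have h1 : 1 - 1 / s ≤ (1 - 1 / s) ^ θ := self_le_rpow_of_le_one hl hu hθ.2.le
      have h2 : 1 / s ≤ s ^ (-α) := by
        rw [one_div, ← rpow_neg_one]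
        exact rpow_le_rpow_of_exponent_le hs (by linarith [hα.2, hθ.1])
      linarith
    rw [picard_succ n hs]
    calc T θ (picard θ n) s ≤ s ^ (-α) + c * (1 / (1 - c)) * s ^ (-α) := by
          linarith [le_abs_self (T θ (picard θ n) s - (1 - (1 - 1 / s) ^ θ))]
      _ = 1 / (1 - c) * s ^ (-α) := by
          field_simp
          ring

theorem tendsto_T {θ s : ℝ} (hθ : 0 < θ) (hs : 1 ≤ s) {F : ℕ → ℝ → ℝ} {f : ℝ → ℝ}
    (hF : ∀ n, Measurable (F n)) (hF1 : ∀ n t, 1 ≤ t → |F n t| ≤ 1)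
    (h : ∀ t, 1 ≤ t → Filter.Tendsto (fun n => F n t) Filter.atTop (nhds (f t))) :
    Filter.Tendsto (fun n => T θ (F n) s) Filter.atTop (nhds (T θ f s)) := by
  refine Filter.Tendsto.const_add _ (Filter.Tendsto.const_mul _ ?_)
  refine tendsto_integral_of_dominated_convergence (fun t : ℝ => (s + t - 1) ^ (-θ - 1))
    (fun n => (integrableOn_kernel_mul hθ hs (hF n) (hF1 n)).aestronglyMeasurable)
    (integrableOn_kernel hθ hs) (fun n => ?_) ?_
  · refine (ae_restrict_iff' measurableSet_Ioi).2 (Filter.Eventually.of_forall fun t ht => ?_)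
    have ht1 : (1 : ℝ) < t := ht
    have h0 : 0 ≤ (s + t - 1) ^ (-θ - 1) := rpow_nonneg (by linarith) _
    rw [norm_mul, norm_of_nonneg h0, Real.norm_eq_abs]
    exact mul_le_of_le_one_right h0 (hF1 n t ht1.le)
  · refine (ae_restrict_iff' measurableSet_Ioi).2 (Filter.Eventually.of_forall fun t ht => ?_)
    exact (h t (le_of_lt ht)).const_mul _

theorem exists_fixed_point {θ α : ℝ} (hθ : θ ∈ Ioo (0 : ℝ) 1) (hα : α ∈ Ioo (0 : ℝ) (1 - θ)) :
    ∃ f : ℝ → ℝ, MemF α f ∧ ∀ s, 1 ≤ s → T θ f s = f s := by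
  obtain ⟨c, -, hc1, hc⟩ := exists_contraction_const hθ hα
  set f : ℝ → ℝ := fun s => ⨆ n, picard θ n s with hf
  have hlim : ∀ s, 1 ≤ s →
      Filter.Tendsto (fun n => picard θ n s) Filter.atTop (nhds (f s)) := fun s hs =>
    tendsto_atTop_ciSup (monotone_nat_of_le_succ fun n => picard_le_succ hθ.1 n s hs)
      ⟨1, by rintro _ ⟨n, rfl⟩; exact (picard_mem_Icc hθ.1 n s hs).2⟩
  have hmem : ∀ s, 1 ≤ s → f s ∈ Icc (0 : ℝ) 1 := fun s hs =>
    isClosed_Icc.mem_of_tendsto (hlim s hs)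
      (Filter.Eventually.of_forall fun n => picard_mem_Icc hθ.1 n s hs)
  refine ⟨f, ⟨Measurable.iSup (measurable_picard θ), hmem, 1 / (1 - c), ?_⟩, fun s hs => ?_⟩
  · rintro _ ⟨s, hs, rfl⟩
    have hs1 : (1 : ℝ) ≤ s := hs
    have hs0 : 0 < s := by linarith
    have h := le_of_tendsto' (hlim s hs) fun n => picard_le hθ hα hc1 hc n s hs
    simp only
    rw [rpow_neg hs0.le, ← div_eq_mul_inv, le_div_iff₀ (rpow_pos_of_pos hs0 _), mul_comm] at h
    rwa [abs_of_nonneg (hmem s hs).1]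
  · refine tendsto_nhds_unique (tendsto_T hθ.1 hs (measurable_picard θ)
      (abs_picard_le_one hθ.1) hlim) ?_
    refine ((Filter.tendsto_add_atTop_iff_nat 1).2 (hlim s hs)).congr fun n => ?_
    exact picard_succ n hs

/-- For `θ ∈ (0,1)` and `α ∈ (0, 1−θ)`, there exists a fixed point
of `T` in `F_α`, and it is unique in the sense that any two fixed points of `T` in
`F_α` agree almost everywhere on `[1,∞)`. -/
theorem exists_unique_fixed_point (θ α : ℝ) (hθ : θ ∈ Ioo (0 : ℝ) 1)
    (hα : α ∈ Ioo (0 : ℝ) (1 - θ)) :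
    (∃ f : ℝ → ℝ, MemF α f ∧ ∀ s, 1 ≤ s → T θ f s = f s) ∧
      (∀ f g : ℝ → ℝ, MemF α f → (∀ s, 1 ≤ s → T θ f s = f s) →
        MemF α g → (∀ s, 1 ≤ s → T θ g s = g s) →
        ∀ᵐ s ∂(volume.restrict (Ici (1 : ℝ))), f s = g s) := by
  refine ⟨exists_fixed_point hθ hα, fun f g hf hfT hg hgT => ?_⟩
  exact (ae_restrict_iff' measurableSet_Ici).2 (Filter.Eventually.of_forall fun s hs =>
    hf.eq_of_fixed hθ hα hfT hg hgT hs)
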